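/- Let X be a sub-Gaussian random vector in ℝ^d whose function A(h) = |h|²/2 − K(h), K(h) = log E exp(⟨h,X⟩), satisfies A(h) ≥ 0 for all h ∈ ℝ^d. Then for every ε > 0 there exists δ > 0 such that for all h ∈ ℝ^d with A(h) ≤ δ, every eigenvalue of K''(h) is at most 1 + ε (equivalently ⟨K''(h)θ,θ⟩ ≤ 1 + ε for all unit vectors θ); in particular, det K''(h) ≤ (1 + ε)^d for all such h. -/

import Mathlib

open MeasureTheory ProbabilityTheory Real Filter
open scoped ENNReal RealInnerProductSpace Topology

/-- A probability distribution on `ℝ^d` is sub-Gaussian if `E exp(c|X|²) < ∞` for some `c > 0`. -/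
def IsSubGaussian {d : ℕ} (μ : Measure (EuclideanSpace ℝ (Fin d))) : Prop :=
  ∃ c > 0, Integrable (fun x => Real.exp (c * ‖x‖ ^ 2)) μ

/-- The log-Laplace transform `K(t) = log ∫ e^{⟨t,x⟩} dμ(x)`. -/
noncomputable def Kfun {d : ℕ} (μ : Measure (EuclideanSpace ℝ (Fin d)))
    (t : EuclideanSpace ℝ (Fin d)) : ℝ :=
  Real.log (∫ x, Real.exp ⟪t, x⟫ ∂μ)

/-- The function `A(t) = |t|²/2 - K(t)`. -/
noncomputable def Afun {d : ℕ} (μ : Measure (EuclideanSpace ℝ (Fin d)))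
    (t : EuclideanSpace ℝ (Fin d)) : ℝ :=
  ‖t‖ ^ 2 / 2 - Kfun μ t

/-- The Hessian matrix of a function on `ℝ^d`, in the standard basis. -/
noncomputable def hessMatrix {d : ℕ} (f : EuclideanSpace ℝ (Fin d) → ℝ)
    (t : EuclideanSpace ℝ (Fin d)) : Matrix (Fin d) (Fin d) ℝ :=
  Matrix.of fun i j =>
    iteratedFDeriv ℝ 2 f t ![EuclideanSpace.single i 1, EuclideanSpace.single j 1]

/-- The second derivative of a differentiable function, evaluated on the diagonal, is the second
derivative along a line. -/
lemma iteratedFDeriv_two_diag_eq_iteratedDeriv_line {E : Type*} [NormedAddCommGroup E]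
    [NormedSpace ℝ E] {f : E → ℝ} (hf : Differentiable ℝ f) {h : E}
    (hf' : DifferentiableAt ℝ (fderiv ℝ f) h) (θ : E) :
    iteratedFDeriv ℝ 2 f h ![θ, θ] = iteratedDeriv 2 (fun s : ℝ => f (h + s • θ)) 0 := by
  have hline : ∀ s : ℝ, HasDerivAt (fun s : ℝ => h + s • θ) θ s := fun s => by
    simpa using ((hasDerivAt_id s).smul_const θ).const_add h
  have hd : ∀ s : ℝ, HasDerivAt (fun s : ℝ => f (h + s • θ)) (fderiv ℝ f (h + s • θ) θ) s :=
    fun s => (hf _).hasFDerivAt.comp_hasDerivAt s (hline s)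
  have happly : DifferentiableAt ℝ (fun y => fderiv ℝ f y θ) (h + (0 : ℝ) • θ) := by
    rw [zero_smul, add_zero]
    exact hf'.clm_apply (differentiableAt_const θ)
  have hd' : HasDerivAt (fun s : ℝ => fderiv ℝ f (h + s • θ) θ)
      (fderiv ℝ (fun y => fderiv ℝ f y θ) (h + (0 : ℝ) • θ) θ) 0 :=
    HasFDerivAt.comp_hasDerivAt (l := fun y => fderiv ℝ f y θ) (0 : ℝ) happly.hasFDerivAt (hline 0)
  rw [iteratedFDeriv_two_apply, iteratedDeriv_succ, iteratedDeriv_one, funext fun s => (hd s).deriv,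
    hd'.deriv, zero_smul, add_zero, fderiv_clm_apply hf' (differentiableAt_const θ)]
  simp

/-- A symmetric real matrix whose quadratic form lies between `0` and `c` on the unit sphere has
determinant at most `c ^ d`. -/
lemma Matrix.IsHermitian.det_le_pow_of_quadForm_le {d : ℕ} {A : Matrix (Fin d) (Fin d) ℝ}
    (hA : A.IsHermitian) {c : ℝ}
    (h0 : ∀ θ : EuclideanSpace ℝ (Fin d), ‖θ‖ = 1 → 0 ≤ θ.ofLp ⬝ᵥ A.mulVec θ.ofLp)
    (hc : ∀ θ : EuclideanSpace ℝ (Fin d), ‖θ‖ = 1 → θ.ofLp ⬝ᵥ A.mulVec θ.ofLp ≤ c) :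
    A.det ≤ c ^ d := by
  have hev : ∀ i, hA.eigenvalues i =
      (hA.eigenvectorBasis i).ofLp ⬝ᵥ A.mulVec (hA.eigenvectorBasis i).ofLp := fun i => by
    simpa using hA.eigenvalues_eq i
  have hn : ∀ i, ‖hA.eigenvectorBasis i‖ = 1 := hA.eigenvectorBasis.orthonormal.1
  rw [hA.det_eq_prod_eigenvalues]
  calc ∏ i, hA.eigenvalues i ≤ ∏ _i : Fin d, c :=
        Finset.prod_le_prod (fun i _ => hev i ▸ h0 _ (hn i)) (fun i _ => hev i ▸ hc _ (hn i))
    _ = c ^ d := by simp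

lemma dotProduct_hessMatrix_mulVec {d : ℕ} (f : EuclideanSpace ℝ (Fin d) → ℝ)
    (h θ : EuclideanSpace ℝ (Fin d)) :
    θ.ofLp ⬝ᵥ (hessMatrix f h).mulVec θ.ofLp = iteratedFDeriv ℝ 2 f h ![θ, θ] := by
  have hθ : θ = ∑ i, θ i • EuclideanSpace.single i (1 : ℝ) := by
    simpa using ((EuclideanSpace.basisFun (Fin d) ℝ).sum_repr θ).symm
  simp only [iteratedFDeriv_two_apply, hessMatrix, dotProduct, Matrix.mulVec, Matrix.of_apply,
    Matrix.cons_val_zero, Matrix.cons_val_one]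
  conv_rhs => rw [hθ]
  simp only [map_sum, map_smul, _root_.sum_apply, _root_.smul_apply,
    smul_eq_mul, Finset.mul_sum]
  rw [Finset.sum_comm]
  refine Finset.sum_congr rfl fun i _ => Finset.sum_congr rfl fun j _ => ?_
  ring

lemma Real.one_add_sq_div_two_le_cosh (x : ℝ) : 1 + x ^ 2 / 2 ≤ cosh x := by
  have hy : 0 ≤ |x| / 2 := by positivity
  have h1 := Real.self_le_sinh_iff.2 hy
  have h2 := Real.cosh_two_mul (|x| / 2)
  rw [mul_div_cancel₀ _ two_ne_zero, Real.cosh_abs, Real.cosh_sq] at h2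
  have h3 := sq_abs x
  nlinarith

/-- A bound on the moment generating function at `±s` bounds the second moment. -/
lemma integral_sq_le_of_mgf_le {Ω : Type*} [MeasurableSpace Ω] {ν : Measure Ω}
    [IsProbabilityMeasure ν] {Y : Ω → ℝ} {s M : ℝ} (hs : 0 < s)
    (hint : Integrable (fun ω => exp (s * Y ω)) ν)
    (hint' : Integrable (fun ω => exp (-s * Y ω)) ν)
    (hM : mgf Y ν s ≤ M) (hM' : mgf Y ν (-s) ≤ M) :
    ∫ ω, Y ω ^ 2 ∂ν ≤ 2 * (M - 1) / s ^ 2 := by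
  have hle : ∀ ω, Y ω ^ 2 ≤ (exp (s * Y ω) + exp (-s * Y ω) - 2) / s ^ 2 := fun ω => by
    rw [le_div_iff₀ (by positivity)]
    have h1 := Real.one_add_sq_div_two_le_cosh (s * Y ω)
    rw [Real.cosh_eq, ← neg_mul] at h1
    nlinarith
  calc ∫ ω, Y ω ^ 2 ∂ν
      ≤ ∫ ω, (exp (s * Y ω) + exp (-s * Y ω) - 2) / s ^ 2 ∂ν :=
        integral_mono_of_nonneg (ae_of_all _ fun ω => sq_nonneg _)
          (((hint.add hint').sub (integrable_const 2)).div_const _) (ae_of_all _ hle)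
    _ = (mgf Y ν s + mgf Y ν (-s) - 2) / s ^ 2 := by
        have hadd : Integrable (fun ω => exp (s * Y ω) + exp (-s * Y ω)) ν := hint.add hint'
        rw [integral_div, integral_sub hadd (integrable_const 2), integral_add hint hint']
        simp [mgf]
    _ ≤ 2 * (M - 1) / s ^ 2 := by
        gcongr
        linarith

section SubGaussian

variable {d : ℕ} {μ : Measure (EuclideanSpace ℝ (Fin d))}

lemma IsSubGaussian.integrable_exp_mul_norm (hsub : IsSubGaussian μ) (R : ℝ) :
    Integrable (fun x => exp (R * ‖x‖)) μ := by
  obtain ⟨c, hc, hint⟩ := hsub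
  refine (hint.const_mul (exp (R ^ 2 / (4 * c)))).mono' (by fun_prop) (ae_of_all _ fun x => ?_)
  rw [norm_of_nonneg (exp_pos _).le, ← exp_add, exp_le_exp]
  have : R ^ 2 / (4 * c) + c * ‖x‖ ^ 2 - R * ‖x‖ = (R - 2 * c * ‖x‖) ^ 2 / (4 * c) := by
    field_simp
    ring
  have : 0 ≤ (R - 2 * c * ‖x‖) ^ 2 / (4 * c) := by positivity
  linarith

lemma IsSubGaussian.integrable_exp_inner (hsub : IsSubGaussian μ)
    (t : EuclideanSpace ℝ (Fin d)) : Integrable (fun x => exp ⟪t, x⟫) μ := by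
  refine (hsub.integrable_exp_mul_norm ‖t‖).mono' (by fun_prop) (ae_of_all _ fun x => ?_)
  rw [norm_of_nonneg (exp_pos _).le, exp_le_exp]
  exact real_inner_le_norm t x

lemma IsSubGaussian.differentiable_Kfun [IsProbabilityMeasure μ] (hsub : IsSubGaussian μ) :
    Differentiable ℝ (Kfun μ) := by
  intro t
  refine DifferentiableAt.log ?_ (integral_exp_pos (hsub.integrable_exp_inner t)).ne'
  refine (hasFDerivAt_integral_of_dominated_of_fderiv_le (Metric.ball_mem_nhds t one_pos)
    (F' := fun t x => exp ⟪t, x⟫ • innerSL ℝ x)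
    (bound := fun x => exp ((‖t‖ + 2) * ‖x‖)) (Eventually.of_forall fun s => ?_)
    (hsub.integrable_exp_inner t) ?_ (ae_of_all _ fun x s hs => ?_)
    (hsub.integrable_exp_mul_norm _) (ae_of_all _ fun x s _ => ?_)).differentiableAt
  · exact (hsub.integrable_exp_inner s).aestronglyMeasurable
  · exact Continuous.aestronglyMeasurable (by fun_prop)
  · have hst : ‖s‖ ≤ ‖t‖ + 1 := by
      have := norm_sub_norm_le s t
      have := mem_ball_iff_norm.1 hs
      linarith
    rw [norm_smul, norm_of_nonneg (exp_pos _).le, innerSL_apply_norm]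
    calc exp ⟪s, x⟫ * ‖x‖ ≤ exp ((‖t‖ + 1) * ‖x‖) * exp ‖x‖ := by
          gcongr
          · exact (real_inner_le_norm s x).trans (by gcongr)
          · linarith [add_one_le_exp ‖x‖]
      _ = exp ((‖t‖ + 2) * ‖x‖) := by
          rw [← exp_add]
          ring_nf
  · have h1 : HasFDerivAt (fun s : EuclideanSpace ℝ (Fin d) => ⟪s, x⟫) (innerSL ℝ x) s := by
      simpa [real_inner_comm] using (innerSL ℝ x).hasFDerivAt (x := s)
    exact h1.exp

lemma IsSubGaussian.exp_Kfun [IsProbabilityMeasure μ] (hsub : IsSubGaussian μ)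
    (t : EuclideanSpace ℝ (Fin d)) : exp (Kfun μ t) = ∫ x, exp ⟪t, x⟫ ∂μ :=
  exp_log (integral_exp_pos (hsub.integrable_exp_inner t))

lemma IsSubGaussian.integrable_exp_mul_inner_tilted [IsProbabilityMeasure μ]
    (hsub : IsSubGaussian μ) (h θ : EuclideanSpace ℝ (Fin d)) (s : ℝ) :
    Integrable (fun x => exp (s * ⟪θ, x⟫)) (μ.tilted fun x => ⟪h, x⟫) := by
  rw [integrable_tilted_iff (hsub.integrable_exp_inner h)]
  simpa [inner_add_left, inner_smul_left, exp_add] using hsub.integrable_exp_inner (h + s • θ)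

lemma IsSubGaussian.mgf_inner_tilted [IsProbabilityMeasure μ] (hsub : IsSubGaussian μ)
    (h θ : EuclideanSpace ℝ (Fin d)) (s : ℝ) :
    mgf (fun x => ⟪θ, x⟫) (μ.tilted fun x => ⟪h, x⟫) s =
      exp (Kfun μ (h + s • θ) - Kfun μ h) := by
  rw [mgf, integral_exp_tilted, exp_sub, hsub.exp_Kfun, hsub.exp_Kfun]
  simp [inner_add_left, inner_smul_left]

lemma IsSubGaussian.iteratedDeriv_two_Kfun_line [IsProbabilityMeasure μ]
    (hsub : IsSubGaussian μ) (h θ : EuclideanSpace ℝ (Fin d)) :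
    iteratedDeriv 2 (fun s : ℝ => Kfun μ (h + s • θ)) 0 =
      Var[fun x => ⟪θ, x⟫; μ.tilted fun x => ⟪h, x⟫] := by
  have hset : integrableExpSet (fun x => ⟪θ, x⟫) (μ.tilted fun x => ⟪h, x⟫) = Set.univ :=
    Set.eq_univ_of_forall (hsub.integrable_exp_mul_inner_tilted h θ)
  have hprob := isProbabilityMeasure_tilted (hsub.integrable_exp_inner h)
  have hvar := variance_tilted_mul (X := fun x => ⟪θ, x⟫) (μ := μ.tilted fun x => ⟪h, x⟫)
    (t := 0) (by simp [hset])
  have hcgf : cgf (fun x => ⟪θ, x⟫) (μ.tilted fun x => ⟪h, x⟫) =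
      fun s => Kfun μ (h + s • θ) - Kfun μ h :=
    funext fun s => by rw [cgf, hsub.mgf_inner_tilted, log_exp]
  simp only [zero_mul, tilted_const] at hvar
  rw [hvar, hcgf]
  simp [iteratedDeriv_succ]

/-- If `A ≥ 0`, the variance of the tilted law in a unit direction is controlled by any upper bound
on `A(h)`. -/
lemma IsSubGaussian.variance_inner_tilted_le [IsProbabilityMeasure μ] (hsub : IsSubGaussian μ)
    (hA : ∀ h, 0 ≤ Afun μ h) {h θ : EuclideanSpace ℝ (Fin d)} (hθ : ‖θ‖ = 1) {δ s : ℝ}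
    (hδ : Afun μ h ≤ δ) (hs : 0 < s) :
    Var[fun x => ⟪θ, x⟫; μ.tilted fun x => ⟪h, x⟫] ≤
      2 * (exp (δ + s ^ 2 / 2) - 1) / s ^ 2 := by
  have hprob := isProbabilityMeasure_tilted (hsub.integrable_exp_inner h)
  set ν := μ.tilted fun x => ⟪h, x⟫ with hν
  have hint : ∀ r : ℝ, Integrable (fun x => exp (r * (⟪θ, x⟫ - ⟪h, θ⟫))) ν := fun r => by
    simpa only [mul_sub, exp_sub] using
      (hsub.integrable_exp_mul_inner_tilted h θ r).div_const (exp (r * ⟪h, θ⟫))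
  have hmgf_sub : ∀ r : ℝ, mgf (fun x => ⟪θ, x⟫ - ⟪h, θ⟫) ν r =
      mgf (fun x => ⟪θ, x⟫) ν r / exp (r * ⟪h, θ⟫) := fun r => by
    simp only [mgf, mul_sub, exp_sub, integral_div]
  have hmgf : ∀ r : ℝ, mgf (fun x => ⟪θ, x⟫ - ⟪h, θ⟫) ν r ≤ exp (δ + r ^ 2 / 2) := fun r => by
    rw [hmgf_sub r, hsub.mgf_inner_tilted, ← exp_sub, exp_le_exp]
    have h1 := hA (h + r • θ)
    have h2 := norm_add_sq_real h (r • θ)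
    rw [norm_smul, hθ, inner_smul_right, mul_one, norm_eq_abs, sq_abs] at h2
    simp only [Afun] at h1 hδ
    linarith
  rw [← variance_sub_const (by fun_prop) ⟪h, θ⟫]
  refine (variance_le_expectation_sq (by fun_prop)).trans ?_
  exact integral_sq_le_of_mgf_le hs (hint s) (hint (-s)) (hmgf s) (by simpa using hmgf (-s))

lemma IsSubGaussian.iteratedFDeriv_two_Kfun_eq_zero_or_variance [IsProbabilityMeasure μ]
    (hsub : IsSubGaussian μ) (h θ : EuclideanSpace ℝ (Fin d)) :
    iteratedFDeriv ℝ 2 (Kfun μ) h ![θ, θ] = 0 ∨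
      iteratedFDeriv ℝ 2 (Kfun μ) h ![θ, θ] =
        Var[fun x => ⟪θ, x⟫; μ.tilted fun x => ⟪h, x⟫] := by
  by_cases hd : DifferentiableAt ℝ (fderiv ℝ (Kfun μ)) h
  · exact .inr ((iteratedFDeriv_two_diag_eq_iteratedDeriv_line hsub.differentiable_Kfun hd θ).trans
      (hsub.iteratedDeriv_two_Kfun_line h θ))
  · left
    simp [iteratedFDeriv_two_apply, fderiv_zero_of_not_differentiableAt hd]

lemma isHermitian_hessMatrix {f : EuclideanSpace ℝ (Fin d) → ℝ} (hf : Differentiable ℝ f)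
    (h : EuclideanSpace ℝ (Fin d)) : (hessMatrix f h).IsHermitian := by
  ext i j
  simp only [hessMatrix, Matrix.conjTranspose_apply, Matrix.of_apply, iteratedFDeriv_two_apply,
    star_trivial, Matrix.cons_val_zero, Matrix.cons_val_one]
  by_cases hd : DifferentiableAt ℝ (fderiv ℝ f) h
  · exact second_derivative_symmetric (fun y => (hf y).hasFDerivAt) hd.hasFDerivAt _ _
  · simp [fderiv_zero_of_not_differentiableAt hd]

end SubGaussian

lemma exists_pos_exp_add_le {ε : ℝ} (hε : 0 < ε) :
    ∃ δ > 0, ∃ s > 0, 2 * (exp (δ + s ^ 2 / 2) - 1) / s ^ 2 ≤ 1 + ε := by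
  have hder : HasDerivAt (fun u : ℝ => exp ((1 + ε / 2) * u)) (1 + ε / 2) 0 := by
    simpa using ((hasDerivAt_id (0 : ℝ)).const_mul (1 + ε / 2)).exp
  obtain ⟨u, hlt, hu⟩ := ((hder.tendsto_slope_zero_right.eventually_lt_const
    (by linarith : 1 + ε / 2 < 1 + ε)).and self_mem_nhdsWithin).exists
  replace hu : 0 < u := hu
  simp only [zero_add, mul_zero, exp_zero, smul_eq_mul, inv_mul_lt_iff₀ hu] at hlt
  refine ⟨ε / 2 * u, by positivity, √(2 * u), by positivity, ?_⟩
  rw [sq_sqrt (by positivity), div_le_iff₀ (by positivity),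
    show ε / 2 * u + 2 * u / 2 = (1 + ε / 2) * u by ring]
  linarith

theorem stmt13 {d : ℕ} (hd : 1 ≤ d)
    (μ : Measure (EuclideanSpace ℝ (Fin d))) [IsProbabilityMeasure μ]
    (hsub : IsSubGaussian μ)
    (hA : ∀ h, 0 ≤ Afun μ h) :
    ∀ ε : ℝ, 0 < ε → ∃ δ : ℝ, 0 < δ ∧
      ∀ h : EuclideanSpace ℝ (Fin d), Afun μ h ≤ δ →
        (∀ θ : EuclideanSpace ℝ (Fin d), ‖θ‖ = 1 →
          iteratedFDeriv ℝ 2 (Kfun μ) h ![θ, θ] ≤ 1 + ε) ∧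
        (hessMatrix (Kfun μ) h).det ≤ (1 + ε) ^ d := by
  intro ε hε
  obtain ⟨δ, hδ, s, hs, hle⟩ := exists_pos_exp_add_le hε
  refine ⟨δ, hδ, fun h hh => ?_⟩
  have hub : ∀ θ : EuclideanSpace ℝ (Fin d), ‖θ‖ = 1 →
      iteratedFDeriv ℝ 2 (Kfun μ) h ![θ, θ] ≤ 1 + ε := fun θ hθ => by
    rcases hsub.iteratedFDeriv_two_Kfun_eq_zero_or_variance h θ with h0 | hv
    · rw [h0]
      positivity
    · rw [hv]
      exact (hsub.variance_inner_tilted_le hA hθ hh hs).trans hle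
  have hlb : ∀ θ : EuclideanSpace ℝ (Fin d), 0 ≤ iteratedFDeriv ℝ 2 (Kfun μ) h ![θ, θ] := fun θ => by
    rcases hsub.iteratedFDeriv_two_Kfun_eq_zero_or_variance h θ with h0 | hv
    · exact h0.ge
    · exact hv ▸ variance_nonneg _ _
  refine ⟨hub, (isHermitian_hessMatrix hsub.differentiable_Kfun h).det_le_pow_of_quadForm_le
    (fun θ _ => ?_) fun θ hθ => ?_⟩
  · exact dotProduct_hessMatrix_mulVec (Kfun μ) h θ ▸ hlb θ
  · exact dotProduct_hessMatrix_mulVec (Kfun μ) h θ ▸ hub θ hθ
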